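/- Let u : ℝ³ → ℝ be a smooth function of (x, y, t) satisfying the universal hierarchy equation u_yy = u_t u_xy − u_y u_tx at every point, and let X : ℝ → ℝ and T : ℝ → ℝ be arbitrary smooth functions (of x and t respectively). Then each of the five functions θ₀(X) = X(x) u_x − X'(x) u, θ₁(X) = X(x), φ₀(T) = T(t) u_t + T'(t) y u_y, φ₁(T) = T(t) u_y, and υ = y u_y + u satisfies the linearized universal hierarchy equation ℓ_E(φ) := φ_yy − u_t φ_xy + u_y φ_xt − u_xy φ_t + u_xt φ_y = 0 at every point of ℝ³. -/

import Mathlib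

noncomputable section

/-- Partial derivative with respect to the first variable (`x`). -/
def Dx (f : ℝ → ℝ → ℝ → ℝ) (x y t : ℝ) : ℝ := deriv (fun x' => f x' y t) x

/-- Partial derivative with respect to the second variable (`y`). -/
def Dy (f : ℝ → ℝ → ℝ → ℝ) (x y t : ℝ) : ℝ := deriv (fun y' => f x y' t) y

/-- Partial derivative with respect to the third variable (`t`). -/
def Dt (f : ℝ → ℝ → ℝ → ℝ) (x y t : ℝ) : ℝ := deriv (fun t' => f x y t') t

/-- Smoothness of a function of three real variables `(x, y, t)`. -/
def Smooth3 (f : ℝ → ℝ → ℝ → ℝ) : Prop :=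
  ContDiff ℝ (⊤ : ℕ∞) (fun p : ℝ × ℝ × ℝ => f p.1 p.2.1 p.2.2)

/-- Linearization of the universal hierarchy equation `u_yy = u_t u_xy - u_y u_tx`
at a solution `u`. -/
def linUHE (u φ : ℝ → ℝ → ℝ → ℝ) (x y t : ℝ) : ℝ :=
  Dy (Dy φ) x y t - Dt u x y t * Dx (Dy φ) x y t + Dy u x y t * Dt (Dx φ) x y t
    - Dx (Dy u) x y t * Dt φ x y t + Dt (Dx u) x y t * Dy φ x y t

open scoped ContDiff

/-- The function of a triple underlying a function of three real variables. -/
def uncurry3 (f : ℝ → ℝ → ℝ → ℝ) (p : ℝ × ℝ × ℝ) : ℝ := f p.1 p.2.1 p.2.2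

section Smooth3

variable {f : ℝ → ℝ → ℝ → ℝ}

theorem Smooth3.contDiff (hf : Smooth3 f) : ContDiff ℝ ∞ (uncurry3 f) := hf

theorem Smooth3.hasFDerivAt (hf : Smooth3 f) (p : ℝ × ℝ × ℝ) :
    HasFDerivAt (uncurry3 f) (fderiv ℝ (uncurry3 f) p) p :=
  (hf.contDiff.differentiable (by simp) p).hasFDerivAt

theorem Smooth3.hasDerivAt_fderiv_x (hf : Smooth3 f) (x y t : ℝ) :
    HasDerivAt (fun x' => f x' y t) (fderiv ℝ (uncurry3 f) (x, y, t) (1, 0, 0)) x :=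
  HasFDerivAt.comp_hasDerivAt (f := fun x' => (x', y, t)) x (hf.hasFDerivAt (x, y, t))
    ((hasDerivAt_id x).prodMk ((hasDerivAt_const x y).prodMk (hasDerivAt_const x t)))

theorem Smooth3.hasDerivAt_fderiv_y (hf : Smooth3 f) (x y t : ℝ) :
    HasDerivAt (fun y' => f x y' t) (fderiv ℝ (uncurry3 f) (x, y, t) (0, 1, 0)) y :=
  HasFDerivAt.comp_hasDerivAt (f := fun y' => (x, y', t)) y (hf.hasFDerivAt (x, y, t))
    ((hasDerivAt_const y x).prodMk ((hasDerivAt_id y).prodMk (hasDerivAt_const y t)))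

theorem Smooth3.hasDerivAt_fderiv_t (hf : Smooth3 f) (x y t : ℝ) :
    HasDerivAt (fun t' => f x y t') (fderiv ℝ (uncurry3 f) (x, y, t) (0, 0, 1)) t :=
  HasFDerivAt.comp_hasDerivAt (f := fun t' => (x, y, t')) t (hf.hasFDerivAt (x, y, t))
    ((hasDerivAt_const t x).prodMk ((hasDerivAt_const t y).prodMk (hasDerivAt_id t)))

theorem Smooth3.uncurry3_Dx (hf : Smooth3 f) :
    uncurry3 (Dx f) = fun p => fderiv ℝ (uncurry3 f) p (1, 0, 0) :=
  funext fun p => (hf.hasDerivAt_fderiv_x p.1 p.2.1 p.2.2).deriv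

theorem Smooth3.uncurry3_Dy (hf : Smooth3 f) :
    uncurry3 (Dy f) = fun p => fderiv ℝ (uncurry3 f) p (0, 1, 0) :=
  funext fun p => (hf.hasDerivAt_fderiv_y p.1 p.2.1 p.2.2).deriv

theorem Smooth3.uncurry3_Dt (hf : Smooth3 f) :
    uncurry3 (Dt f) = fun p => fderiv ℝ (uncurry3 f) p (0, 0, 1) :=
  funext fun p => (hf.hasDerivAt_fderiv_t p.1 p.2.1 p.2.2).deriv

theorem Smooth3.contDiff_fderiv_apply (hf : Smooth3 f) (v : ℝ × ℝ × ℝ) :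
    ContDiff ℝ ∞ (fun p => fderiv ℝ (uncurry3 f) p v) :=
  (hf.contDiff.fderiv_right (m := ∞) (by simp)).clm_apply contDiff_const

theorem Smooth3.Dx (hf : Smooth3 f) : Smooth3 (Dx f) := by
  change ContDiff ℝ ∞ (uncurry3 (_root_.Dx f))
  rw [hf.uncurry3_Dx]
  exact hf.contDiff_fderiv_apply _

theorem Smooth3.Dy (hf : Smooth3 f) : Smooth3 (Dy f) := by
  change ContDiff ℝ ∞ (uncurry3 (_root_.Dy f))
  rw [hf.uncurry3_Dy]
  exact hf.contDiff_fderiv_apply _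

theorem Smooth3.Dt (hf : Smooth3 f) : Smooth3 (Dt f) := by
  change ContDiff ℝ ∞ (uncurry3 (_root_.Dt f))
  rw [hf.uncurry3_Dt]
  exact hf.contDiff_fderiv_apply _

theorem Smooth3.hasDerivAt_x (hf : Smooth3 f) (x y t : ℝ) :
    HasDerivAt (fun x' => f x' y t) (_root_.Dx f x y t) x :=
  (hf.hasDerivAt_fderiv_x x y t).differentiableAt.hasDerivAt

theorem Smooth3.hasDerivAt_y (hf : Smooth3 f) (x y t : ℝ) :
    HasDerivAt (fun y' => f x y' t) (_root_.Dy f x y t) y :=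
  (hf.hasDerivAt_fderiv_y x y t).differentiableAt.hasDerivAt

theorem Smooth3.hasDerivAt_t (hf : Smooth3 f) (x y t : ℝ) :
    HasDerivAt (fun t' => f x y t') (_root_.Dt f x y t) t :=
  (hf.hasDerivAt_fderiv_t x y t).differentiableAt.hasDerivAt

theorem Smooth3.fderiv_fderiv_apply (hf : Smooth3 f) (p v w : ℝ × ℝ × ℝ) :
    fderiv ℝ (fun q => fderiv ℝ (uncurry3 f) q v) p w =
      fderiv ℝ (fderiv ℝ (uncurry3 f)) p w v := by
  have hd : DifferentiableAt ℝ (fderiv ℝ (uncurry3 f)) p :=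
    (hf.contDiff.fderiv_right (m := ∞) (by simp)).differentiable (by simp) p
  rw [(hd.hasFDerivAt.clm_apply (hasFDerivAt_const v p)).fderiv]
  simp

theorem Smooth3.fderiv_fderiv_apply_comm (hf : Smooth3 f) (p v w : ℝ × ℝ × ℝ) :
    fderiv ℝ (fun q => fderiv ℝ (uncurry3 f) q v) p w =
      fderiv ℝ (fun q => fderiv ℝ (uncurry3 f) q w) p v := by
  rw [hf.fderiv_fderiv_apply, hf.fderiv_fderiv_apply]
  exact (hf.contDiff.contDiffAt.isSymmSndFDerivAt
    (by rw [minSmoothness_of_isRCLikeNormedField]; exact WithTop.coe_le_coe.2 le_top)) w v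

theorem Smooth3.Dy_Dx (hf : Smooth3 f) : _root_.Dy (_root_.Dx f) = _root_.Dx (_root_.Dy f) := by
  funext x y t
  rw [(hf.Dx.hasDerivAt_y x y t).unique (hf.Dx.hasDerivAt_fderiv_y x y t),
    (hf.Dy.hasDerivAt_x x y t).unique (hf.Dy.hasDerivAt_fderiv_x x y t),
    hf.uncurry3_Dx, hf.uncurry3_Dy, hf.fderiv_fderiv_apply_comm]

theorem Smooth3.Dt_Dx (hf : Smooth3 f) : _root_.Dt (_root_.Dx f) = _root_.Dx (_root_.Dt f) := by
  funext x y t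
  rw [(hf.Dx.hasDerivAt_t x y t).unique (hf.Dx.hasDerivAt_fderiv_t x y t),
    (hf.Dt.hasDerivAt_x x y t).unique (hf.Dt.hasDerivAt_fderiv_x x y t),
    hf.uncurry3_Dx, hf.uncurry3_Dt, hf.fderiv_fderiv_apply_comm]

theorem Smooth3.Dt_Dy (hf : Smooth3 f) : _root_.Dt (_root_.Dy f) = _root_.Dy (_root_.Dt f) := by
  funext x y t
  rw [(hf.Dy.hasDerivAt_t x y t).unique (hf.Dy.hasDerivAt_fderiv_t x y t),
    (hf.Dt.hasDerivAt_y x y t).unique (hf.Dt.hasDerivAt_fderiv_y x y t),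
    hf.uncurry3_Dy, hf.uncurry3_Dt, hf.fderiv_fderiv_apply_comm]

end Smooth3

theorem ContDiff.hasDerivAt_deriv {g : ℝ → ℝ} (hg : ContDiff ℝ ∞ g) (s : ℝ) :
    HasDerivAt g (deriv g s) s :=
  (hg.differentiable (by simp) s).hasDerivAt

theorem ContDiff.hasDerivAt_deriv_deriv {g : ℝ → ℝ} (hg : ContDiff ℝ ∞ g) (s : ℝ) :
    HasDerivAt (deriv g) (deriv (deriv g) s) s :=
  ((contDiff_infty_iff_deriv.1 hg).2).hasDerivAt_deriv s

/-- The universal hierarchy equation. -/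
def IsUHESolution (u : ℝ → ℝ → ℝ → ℝ) : Prop :=
  ∀ x y t : ℝ, Dy (Dy u) x y t = Dt u x y t * Dx (Dy u) x y t - Dy u x y t * Dt (Dx u) x y t

section Prolongation

variable {u : ℝ → ℝ → ℝ → ℝ}

theorem IsUHESolution.Dx_eq (h : IsUHESolution u) (hu : Smooth3 u) (x y t : ℝ) :
    Dx (Dy (Dy u)) x y t =
      Dx (Dt u) x y t * Dx (Dy u) x y t + Dt u x y t * Dx (Dx (Dy u)) x y t
        - (Dx (Dy u) x y t * Dt (Dx u) x y t + Dy u x y t * Dx (Dt (Dx u)) x y t) :=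
  (hu.Dy.Dy.hasDerivAt_x x y t).unique <|
    (((hu.Dt.hasDerivAt_x x y t).mul (hu.Dy.Dx.hasDerivAt_x x y t)).sub
      ((hu.Dy.hasDerivAt_x x y t).mul (hu.Dx.Dt.hasDerivAt_x x y t))).congr_of_eventuallyEq
      (.of_forall fun x' => h x' y t)

theorem IsUHESolution.Dy_eq (h : IsUHESolution u) (hu : Smooth3 u) (x y t : ℝ) :
    Dy (Dy (Dy u)) x y t =
      Dy (Dt u) x y t * Dx (Dy u) x y t + Dt u x y t * Dy (Dx (Dy u)) x y t
        - (Dy (Dy u) x y t * Dt (Dx u) x y t + Dy u x y t * Dy (Dt (Dx u)) x y t) :=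
  (hu.Dy.Dy.hasDerivAt_y x y t).unique <|
    (((hu.Dt.hasDerivAt_y x y t).mul (hu.Dy.Dx.hasDerivAt_y x y t)).sub
      ((hu.Dy.hasDerivAt_y x y t).mul (hu.Dx.Dt.hasDerivAt_y x y t))).congr_of_eventuallyEq
      (.of_forall fun y' => h x y' t)

theorem IsUHESolution.Dt_eq (h : IsUHESolution u) (hu : Smooth3 u) (x y t : ℝ) :
    Dt (Dy (Dy u)) x y t =
      Dt (Dt u) x y t * Dx (Dy u) x y t + Dt u x y t * Dt (Dx (Dy u)) x y t
        - (Dt (Dy u) x y t * Dt (Dx u) x y t + Dy u x y t * Dt (Dt (Dx u)) x y t) :=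
  (hu.Dy.Dy.hasDerivAt_t x y t).unique <|
    (((hu.Dt.hasDerivAt_t x y t).mul (hu.Dy.Dx.hasDerivAt_t x y t)).sub
      ((hu.Dy.hasDerivAt_t x y t).mul (hu.Dx.Dt.hasDerivAt_t x y t))).congr_of_eventuallyEq
      (.of_forall fun t' => h x y t')

end Prolongation

section Symmetries

variable {u : ℝ → ℝ → ℝ → ℝ} {X T : ℝ → ℝ}

theorem linUHE_x_reparametrization (h : IsUHESolution u) (hu : Smooth3 u) (hX : ContDiff ℝ ∞ X)
    (x y t : ℝ) :
    linUHE u (fun x y t => X x * Dx u x y t - deriv X x * u x y t) x y t = 0 := by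
  have hx : Dx (fun x y t => X x * Dx u x y t - deriv X x * u x y t) =
      fun x y t => X x * Dx (Dx u) x y t - deriv (deriv X) x * u x y t := by
    funext x y t
    refine HasDerivAt.deriv ((((hX.hasDerivAt_deriv x).mul (hu.Dx.hasDerivAt_x x y t)).sub
      ((hX.hasDerivAt_deriv_deriv x).mul (hu.hasDerivAt_x x y t))).congr_deriv ?_)
    ring
  have hy : Dy (fun x y t => X x * Dx u x y t - deriv X x * u x y t) =
      fun x y t => X x * Dx (Dy u) x y t - deriv X x * Dy u x y t := by
    funext x y t
    rw [← hu.Dy_Dx]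
    exact (((hu.Dx.hasDerivAt_y x y t).const_mul _).sub
      ((hu.hasDerivAt_y x y t).const_mul _)).deriv
  have ht : Dt (fun x y t => X x * Dx u x y t - deriv X x * u x y t) x y t =
      X x * Dx (Dt u) x y t - deriv X x * Dt u x y t := by
    rw [← hu.Dt_Dx]
    exact (((hu.Dx.hasDerivAt_t x y t).const_mul _).sub
      ((hu.hasDerivAt_t x y t).const_mul _)).deriv
  have hyy : Dy (fun x y t => X x * Dx (Dy u) x y t - deriv X x * Dy u x y t) x y t =
      X x * Dx (Dy (Dy u)) x y t - deriv X x * Dy (Dy u) x y t := by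
    rw [← hu.Dy.Dy_Dx]
    exact (((hu.Dy.Dx.hasDerivAt_y x y t).const_mul _).sub
      ((hu.Dy.hasDerivAt_y x y t).const_mul _)).deriv
  have hxy : Dx (fun x y t => X x * Dx (Dy u) x y t - deriv X x * Dy u x y t) x y t =
      X x * Dx (Dx (Dy u)) x y t - deriv (deriv X) x * Dy u x y t := by
    refine HasDerivAt.deriv ((((hX.hasDerivAt_deriv x).mul (hu.Dy.Dx.hasDerivAt_x x y t)).sub
      ((hX.hasDerivAt_deriv_deriv x).mul (hu.Dy.hasDerivAt_x x y t))).congr_deriv ?_)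
    ring
  have hxt : Dt (fun x y t => X x * Dx (Dx u) x y t - deriv (deriv X) x * u x y t) x y t =
      X x * Dx (Dx (Dt u)) x y t - deriv (deriv X) x * Dt u x y t := by
    rw [← hu.Dt_Dx, ← hu.Dx.Dt_Dx]
    exact (((hu.Dx.Dx.hasDerivAt_t x y t).const_mul _).sub
      ((hu.hasDerivAt_t x y t).const_mul _)).deriv
  have e := h.Dx_eq hu x y t
  have e0 := h x y t
  rw [linUHE, hy, hx, ht, hyy, hxy, hxt]
  simp only [hu.Dt_Dx] at *
  linear_combination X x * e - deriv X x * e0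

theorem linUHE_x_function (x y t : ℝ) : linUHE u (fun x _ _ => X x) x y t = 0 := by
  simp [linUHE, Dx, Dy, Dt]

theorem linUHE_t_reparametrization (h : IsUHESolution u) (hu : Smooth3 u) (hT : ContDiff ℝ ∞ T)
    (x y t : ℝ) :
    linUHE u (fun x y t => T t * Dt u x y t + deriv T t * y * Dy u x y t) x y t = 0 := by
  have hx : Dx (fun x y t => T t * Dt u x y t + deriv T t * y * Dy u x y t) =
      fun x y t => T t * Dx (Dt u) x y t + deriv T t * y * Dx (Dy u) x y t := by
    funext x y t
    exact (((hu.Dt.hasDerivAt_x x y t).const_mul _).add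
      ((hu.Dy.hasDerivAt_x x y t).const_mul _)).deriv
  have hy : Dy (fun x y t => T t * Dt u x y t + deriv T t * y * Dy u x y t) =
      fun x y t => T t * Dy (Dt u) x y t +
        (deriv T t * Dy u x y t + deriv T t * y * Dy (Dy u) x y t) := by
    funext x y t
    refine HasDerivAt.deriv ((((hu.Dt.hasDerivAt_y x y t).const_mul _).add
      (((hasDerivAt_id y).const_mul _).mul (hu.Dy.hasDerivAt_y x y t))).congr_deriv ?_)
    simp
  have ht : Dt (fun x y t => T t * Dt u x y t + deriv T t * y * Dy u x y t) x y t =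
      deriv T t * Dt u x y t + T t * Dt (Dt u) x y t +
        (deriv (deriv T) t * y * Dy u x y t + deriv T t * y * Dy (Dt u) x y t) := by
    rw [← hu.Dt_Dy]
    exact (((hT.hasDerivAt_deriv t).mul (hu.Dt.hasDerivAt_t x y t)).add
      (((hT.hasDerivAt_deriv_deriv t).mul_const y).mul (hu.Dy.hasDerivAt_t x y t))).deriv
  have hyy : Dy (fun x y t => T t * Dy (Dt u) x y t +
        (deriv T t * Dy u x y t + deriv T t * y * Dy (Dy u) x y t)) x y t =
      T t * Dy (Dy (Dt u)) x y t +
        (2 * deriv T t * Dy (Dy u) x y t + deriv T t * y * Dy (Dy (Dy u)) x y t) := by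
    refine HasDerivAt.deriv ((((hu.Dt.Dy.hasDerivAt_y x y t).const_mul _).add
      (((hu.Dy.hasDerivAt_y x y t).const_mul _).add
        (((hasDerivAt_id y).const_mul _).mul (hu.Dy.Dy.hasDerivAt_y x y t)))).congr_deriv ?_)
    simp only [id]
    ring
  have hxy : Dx (fun x y t => T t * Dy (Dt u) x y t +
        (deriv T t * Dy u x y t + deriv T t * y * Dy (Dy u) x y t)) x y t =
      T t * Dx (Dy (Dt u)) x y t +
        (deriv T t * Dx (Dy u) x y t + deriv T t * y * Dx (Dy (Dy u)) x y t) :=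
    (((hu.Dt.Dy.hasDerivAt_x x y t).const_mul _).add
      (((hu.Dy.hasDerivAt_x x y t).const_mul _).add
        ((hu.Dy.Dy.hasDerivAt_x x y t).const_mul _))).deriv
  have hxt : Dt (fun x y t => T t * Dx (Dt u) x y t + deriv T t * y * Dx (Dy u) x y t) x y t =
      deriv T t * Dx (Dt u) x y t + T t * Dx (Dt (Dt u)) x y t +
        (deriv (deriv T) t * y * Dx (Dy u) x y t + deriv T t * y * Dx (Dy (Dt u)) x y t) := by
    rw [← hu.Dt_Dy, ← hu.Dt.Dt_Dx, ← hu.Dy.Dt_Dx]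
    exact (((hT.hasDerivAt_deriv t).mul (hu.Dt.Dx.hasDerivAt_t x y t)).add
      (((hT.hasDerivAt_deriv_deriv t).mul_const y).mul (hu.Dy.Dx.hasDerivAt_t x y t))).deriv
  have e0 := h x y t
  have ey := h.Dy_eq hu x y t
  have et := h.Dt_eq hu x y t
  rw [linUHE, hy, hx, ht, hyy, hxy, hxt]
  simp only [hu.Dt_Dx, hu.Dt_Dy, hu.Dy.Dt_Dx, hu.Dy.Dt_Dy, hu.Dt.Dt_Dx, hu.Dt.Dy_Dx,
    hu.Dy.Dy_Dx] at *
  linear_combination T t * et + deriv T t * y * ey + 2 * deriv T t * e0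

theorem linUHE_t_function_mul_Dy (h : IsUHESolution u) (hu : Smooth3 u) (hT : ContDiff ℝ ∞ T)
    (x y t : ℝ) :
    linUHE u (fun x y t => T t * Dy u x y t) x y t = 0 := by
  have hx : Dx (fun x y t => T t * Dy u x y t) = fun x y t => T t * Dx (Dy u) x y t := by
    funext x y t
    exact ((hu.Dy.hasDerivAt_x x y t).const_mul _).deriv
  have hy : Dy (fun x y t => T t * Dy u x y t) = fun x y t => T t * Dy (Dy u) x y t := by
    funext x y t
    exact ((hu.Dy.hasDerivAt_y x y t).const_mul _).deriv
  have ht : Dt (fun x y t => T t * Dy u x y t) x y t =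
      deriv T t * Dy u x y t + T t * Dt (Dy u) x y t :=
    ((hT.hasDerivAt_deriv t).mul (hu.Dy.hasDerivAt_t x y t)).deriv
  have hyy : Dy (fun x y t => T t * Dy (Dy u) x y t) x y t = T t * Dy (Dy (Dy u)) x y t :=
    ((hu.Dy.Dy.hasDerivAt_y x y t).const_mul _).deriv
  have hxy : Dx (fun x y t => T t * Dy (Dy u) x y t) x y t = T t * Dx (Dy (Dy u)) x y t :=
    ((hu.Dy.Dy.hasDerivAt_x x y t).const_mul _).deriv
  have hxt : Dt (fun x y t => T t * Dx (Dy u) x y t) x y t =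
      deriv T t * Dx (Dy u) x y t + T t * Dt (Dx (Dy u)) x y t :=
    ((hT.hasDerivAt_deriv t).mul (hu.Dy.Dx.hasDerivAt_t x y t)).deriv
  have ey := h.Dy_eq hu x y t
  rw [linUHE, hy, hx, ht, hyy, hxy, hxt]
  simp only [hu.Dt_Dx, hu.Dt_Dy, hu.Dy.Dt_Dx, hu.Dt.Dy_Dx, hu.Dy.Dy_Dx] at *
  linear_combination T t * ey

theorem linUHE_scaling (h : IsUHESolution u) (hu : Smooth3 u) (x y t : ℝ) :
    linUHE u (fun x y t => y * Dy u x y t + u x y t) x y t = 0 := by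
  have hx : Dx (fun x y t => y * Dy u x y t + u x y t) =
      fun x y t => y * Dx (Dy u) x y t + Dx u x y t := by
    funext x y t
    exact (((hu.Dy.hasDerivAt_x x y t).const_mul _).add (hu.hasDerivAt_x x y t)).deriv
  have hy : Dy (fun x y t => y * Dy u x y t + u x y t) =
      fun x y t => y * Dy (Dy u) x y t + 2 * Dy u x y t := by
    funext x y t
    refine HasDerivAt.deriv ((((hasDerivAt_id y).mul (hu.Dy.hasDerivAt_y x y t)).add
      (hu.hasDerivAt_y x y t)).congr_deriv ?_)
    simp only [id]
    ring
  have ht : Dt (fun x y t => y * Dy u x y t + u x y t) x y t =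
      y * Dt (Dy u) x y t + Dt u x y t :=
    (((hu.Dy.hasDerivAt_t x y t).const_mul _).add (hu.hasDerivAt_t x y t)).deriv
  have hyy : Dy (fun x y t => y * Dy (Dy u) x y t + 2 * Dy u x y t) x y t =
      y * Dy (Dy (Dy u)) x y t + 3 * Dy (Dy u) x y t := by
    refine HasDerivAt.deriv ((((hasDerivAt_id y).mul (hu.Dy.Dy.hasDerivAt_y x y t)).add
      ((hu.Dy.hasDerivAt_y x y t).const_mul _)).congr_deriv ?_)
    simp only [id]
    ring
  have hxy : Dx (fun x y t => y * Dy (Dy u) x y t + 2 * Dy u x y t) x y t =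
      y * Dx (Dy (Dy u)) x y t + 2 * Dx (Dy u) x y t :=
    (((hu.Dy.Dy.hasDerivAt_x x y t).const_mul _).add
      ((hu.Dy.hasDerivAt_x x y t).const_mul _)).deriv
  have hxt : Dt (fun x y t => y * Dx (Dy u) x y t + Dx u x y t) x y t =
      y * Dt (Dx (Dy u)) x y t + Dt (Dx u) x y t :=
    (((hu.Dy.Dx.hasDerivAt_t x y t).const_mul _).add (hu.Dx.hasDerivAt_t x y t)).deriv
  have e0 := h x y t
  have ey := h.Dy_eq hu x y t
  rw [linUHE, hy, hx, ht, hyy, hxy, hxt]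
  simp only [hu.Dt_Dx, hu.Dt_Dy, hu.Dy.Dt_Dx, hu.Dt.Dy_Dx, hu.Dy.Dy_Dx] at *
  linear_combination y * ey + 3 * e0

end Symmetries

/-- Local symmetries of the universal hierarchy equation. -/
theorem uhe_local_symmetries
    (u : ℝ → ℝ → ℝ → ℝ) (hu : Smooth3 u)
    (husol : ∀ x y t : ℝ, Dy (Dy u) x y t = Dt u x y t * Dx (Dy u) x y t - Dy u x y t * Dt (Dx u) x y t)
    (X T : ℝ → ℝ) (hX : ContDiff ℝ (⊤ : ℕ∞) X) (hT : ContDiff ℝ (⊤ : ℕ∞) T) :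
    (∀ x y t : ℝ,
      linUHE u (fun x y t => X x * Dx u x y t - deriv X x * u x y t) x y t = 0) ∧
    (∀ x y t : ℝ,
      linUHE u (fun x y t => X x) x y t = 0) ∧
    (∀ x y t : ℝ,
      linUHE u (fun x y t => T t * Dt u x y t + deriv T t * y * Dy u x y t) x y t = 0) ∧
    (∀ x y t : ℝ,
      linUHE u (fun x y t => T t * Dy u x y t) x y t = 0) ∧
    (∀ x y t : ℝ,
      linUHE u (fun x y t => y * Dy u x y t + u x y t) x y t = 0) := by
  exact ⟨linUHE_x_reparametrization husol hu hX, linUHE_x_function,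
    linUHE_t_reparametrization husol hu hT, linUHE_t_function_mul_Dy husol hu hT,
    linUHE_scaling husol hu⟩
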